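/- arXiv:1511.08408 — 9 statements merged into one kernel-verified Lean document; each statement's English description precedes it below -/
import Mathlib

section
/- Under the SBP CPR semidiscretisation of Burgers' equation with generalised correction terms, for every test vector v ∈ ℝⁿ one has the identity vᵀ·M·du = (1/3)·vᵀ·Dᵀ·M·U·u − (1/3)·vᵀ·Uᵀ·M·D·u − vᵀ·Rᵀ·B·fnum + (1/6)·vᵀ·Rᵀ·B·((R·u) ∘ (R·u)). -/
open Matrix

/-- Under the SBP CPR semidiscretisation of Burgers' equation with generalised
correction terms, for every test vector `v` one has
`vᵀ·M·du = (1/3)·vᵀ·Dᵀ·M·U·u − (1/3)·vᵀ·Uᵀ·M·D·u − vᵀ·Rᵀ·B·fnum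
          + (1/6)·vᵀ·Rᵀ·B·((R·u) ∘ (R·u))`. -/
theorem stmt_0 (n : ℕ) (hn : 1 ≤ n)
    (M D U : Matrix (Fin n) (Fin n) ℝ) (R : Matrix (Fin 2) (Fin n) ℝ)
    (B : Matrix (Fin 2) (Fin 2) ℝ) (hB : B = !![(-1 : ℝ), 0; 0, 1])
    (hM : M.IsSymm) (hMpd : M.PosDef)
    (hSBP : M * D + Dᵀ * M = Rᵀ * B * R)
    (u : Fin n → ℝ) (fnum : Fin 2 → ℝ)
    (cdiv : Fin n → ℝ)
    (hcdiv : cdiv = (1/3 : ℝ) •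
      (M⁻¹ *ᵥ (Uᵀ *ᵥ (M *ᵥ (D *ᵥ u))) - (1/2 : ℝ) • (D *ᵥ (U *ᵥ u))))
    (cres : Fin 2 → ℝ)
    (hcres : cres = (1/6 : ℝ) • ((R *ᵥ u) * (R *ᵥ u) - R *ᵥ (U *ᵥ u)))
    (du : Fin n → ℝ)
    (hdu : du = -((D *ᵥ ((1/2 : ℝ) • (U *ᵥ u))) + cdiv
        + M⁻¹ *ᵥ (Rᵀ *ᵥ (B *ᵥ (fnum - R *ᵥ ((1/2 : ℝ) • (U *ᵥ u)) - cres)))))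
    (v : Fin n → ℝ) :
    v ⬝ᵥ (M *ᵥ du)
      = (1/3 : ℝ) * (v ⬝ᵥ (Dᵀ *ᵥ (M *ᵥ (U *ᵥ u))))
        - (1/3 : ℝ) * (v ⬝ᵥ (Uᵀ *ᵥ (M *ᵥ (D *ᵥ u))))
        - v ⬝ᵥ (Rᵀ *ᵥ (B *ᵥ fnum))
        + (1/6 : ℝ) * (v ⬝ᵥ (Rᵀ *ᵥ (B *ᵥ ((R *ᵥ u) * (R *ᵥ u))))) := by
  have hdet : IsUnit M.det := (Matrix.isUnit_iff_isUnit_det M).mp hMpd.isUnit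
  have hinv (w : Fin n → ℝ) : M *ᵥ (M⁻¹ *ᵥ w) = w := by
    rw [mulVec_mulVec, mul_nonsing_inv _ hdet, one_mulVec]
  have hparts : v ⬝ᵥ (Rᵀ *ᵥ (B *ᵥ (R *ᵥ (U *ᵥ u))))
      = v ⬝ᵥ (M *ᵥ (D *ᵥ (U *ᵥ u))) + v ⬝ᵥ (Dᵀ *ᵥ (M *ᵥ (U *ᵥ u))) := by
    have h := congrArg (fun A => v ⬝ᵥ (A *ᵥ (U *ᵥ u))) hSBP
    simp only [add_mulVec, ← mulVec_mulVec, dotProduct_add] at h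
    exact h.symm
  rw [hdu, hcdiv, hcres]
  simp only [mulVec_neg, mulVec_add, mulVec_sub, mulVec_smul, hinv, dotProduct_neg,
    dotProduct_add, dotProduct_sub, dotProduct_smul, smul_eq_mul, hparts]
  ring
end

section
/- Under the SBP CPR semidiscretisation of Burgers' equation with generalised correction terms, the discrete energy rate of a single element satisfies uᵀ·M·du = −uᵀ·Rᵀ·B·fnum + (1/6)·uᵀ·Rᵀ·B·((R·u) ∘ (R·u)); i.e. writing u_L = (R·u)₀, u_R = (R·u)₁, f_L = fnum₀, f_R = fnum₁, one has uᵀ·M·du = u_L·f_L − u_R·f_R + (1/6)·(u_R³ − u_L³). -/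
open Matrix

/-- Under the SBP CPR semidiscretisation of Burgers' equation with generalised
correction terms, the discrete energy rate of a single element satisfies
`uᵀ·M·du = −uᵀ·Rᵀ·B·fnum + (1/6)·uᵀ·Rᵀ·B·((R·u) ∘ (R·u))`, i.e.
`uᵀ·M·du = u_L·f_L − u_R·f_R + (1/6)·(u_R³ − u_L³)`. -/
theorem stmt_1 (n : ℕ) (hn : 1 ≤ n)
    (M D U : Matrix (Fin n) (Fin n) ℝ) (R : Matrix (Fin 2) (Fin n) ℝ)
    (B : Matrix (Fin 2) (Fin 2) ℝ) (hB : B = !![(-1 : ℝ), 0; 0, 1])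
    (hM : M.IsSymm) (hMpd : M.PosDef)
    (hSBP : M * D + Dᵀ * M = Rᵀ * B * R)
    (u : Fin n → ℝ) (fnum : Fin 2 → ℝ)
    (cdiv : Fin n → ℝ)
    (hcdiv : cdiv = (1/3 : ℝ) •
      (M⁻¹ *ᵥ (Uᵀ *ᵥ (M *ᵥ (D *ᵥ u))) - (1/2 : ℝ) • (D *ᵥ (U *ᵥ u))))
    (cres : Fin 2 → ℝ)
    (hcres : cres = (1/6 : ℝ) • ((R *ᵥ u) * (R *ᵥ u) - R *ᵥ (U *ᵥ u)))
    (du : Fin n → ℝ)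
    (hdu : du = -((D *ᵥ ((1/2 : ℝ) • (U *ᵥ u))) + cdiv
        + M⁻¹ *ᵥ (Rᵀ *ᵥ (B *ᵥ (fnum - R *ᵥ ((1/2 : ℝ) • (U *ᵥ u)) - cres))))) :
    u ⬝ᵥ (M *ᵥ du)
      = - (u ⬝ᵥ (Rᵀ *ᵥ (B *ᵥ fnum)))
        + (1/6 : ℝ) * (u ⬝ᵥ (Rᵀ *ᵥ (B *ᵥ ((R *ᵥ u) * (R *ᵥ u)))))
    ∧ u ⬝ᵥ (M *ᵥ du)
      = (R *ᵥ u) 0 * fnum 0 - (R *ᵥ u) 1 * fnum 1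
        + (1/6 : ℝ) * (((R *ᵥ u) 1)^3 - ((R *ᵥ u) 0)^3) := by
  have hdet : IsUnit M.det := (Matrix.isUnit_iff_isUnit_det M).mp hMpd.isUnit
  have hinv (v : Fin n → ℝ) : M *ᵥ (M⁻¹ *ᵥ v) = v := by
    rw [mulVec_mulVec, mul_nonsing_inv M hdet, one_mulVec]
  have htranspose {m : ℕ} (A : Matrix (Fin m) (Fin n) ℝ) (v : Fin n → ℝ) (w : Fin m → ℝ) :
      v ⬝ᵥ (Aᵀ *ᵥ w) = (A *ᵥ v) ⬝ᵥ w := by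
    rw [mulVec_transpose, dotProduct_comm, ← dotProduct_mulVec, dotProduct_comm]
  have hparts : u ⬝ᵥ (M *ᵥ (D *ᵥ (U *ᵥ u))) + (U *ᵥ u) ⬝ᵥ (M *ᵥ (D *ᵥ u))
      = u ⬝ᵥ (Rᵀ *ᵥ (B *ᵥ (R *ᵥ (U *ᵥ u)))) := by
    have hsymm : (U *ᵥ u) ⬝ᵥ (M *ᵥ (D *ᵥ u)) = u ⬝ᵥ (Dᵀ *ᵥ (M *ᵥ (U *ᵥ u))) := by
      rw [htranspose D, dotProduct_comm (D *ᵥ u), ← htranspose M, hM.eq]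
    have h := congrArg (fun A => u ⬝ᵥ (A *ᵥ (U *ᵥ u))) hSBP
    simpa only [add_mulVec, ← mulVec_mulVec, dotProduct_add, hsymm] using h
  have henergy : u ⬝ᵥ (M *ᵥ du)
      = - (u ⬝ᵥ (Rᵀ *ᵥ (B *ᵥ fnum)))
        + (1/6 : ℝ) * (u ⬝ᵥ (Rᵀ *ᵥ (B *ᵥ ((R *ᵥ u) * (R *ᵥ u))))) := by
    subst hdu hcdiv hcres
    simp only [mulVec_neg, mulVec_add, mulVec_sub, mulVec_smul, hinv, dotProduct_neg,
      dotProduct_add, dotProduct_sub, dotProduct_smul, smul_eq_mul, htranspose U]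
    linear_combination (-1 / 3 : ℝ) * hparts
  refine ⟨henergy, henergy.trans ?_⟩
  rw [htranspose R, htranspose R, hB]
  simp [dotProduct, mulVec, Fin.sum_univ_two]
  ring
end

section
/- (Theorem 2, stability part.) Under the periodic SBP CPR semidiscretisation of Burgers' equation with generalised correction terms, if the interface fluxes are entropy stable, i.e. (1/6)·((u⁻_k)³ − (u⁺_k)³) − (u⁻_k − u⁺_k)·g_k ≤ 0 for every k ∈ ZMod N, then the total discrete energy is nonincreasing: Σ_{k ∈ ZMod N} (u_k)ᵀ·M·du_k ≤ 0. -/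
open Matrix

/-- Summation by parts in bilinear form. -/
lemma dotProduct_mulVec_add_of_sbp {m n : Type*} [Fintype m] [Fintype n]
    {M D : Matrix n n ℝ} {R : Matrix m n ℝ} {B : Matrix m m ℝ} (hM : M.IsSymm)
    (hSBP : M * D + Dᵀ * M = Rᵀ * B * R) (v w : n → ℝ) :
    v ⬝ᵥ (M *ᵥ (D *ᵥ w)) + w ⬝ᵥ (M *ᵥ (D *ᵥ v)) = (R *ᵥ v) ⬝ᵥ (B *ᵥ (R *ᵥ w)) := by
  have h := congrArg (fun A => v ⬝ᵥ (A *ᵥ w)) hSBP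
  have hswap : w ⬝ᵥ (M *ᵥ (D *ᵥ v)) = v ⬝ᵥ (Dᵀ *ᵥ (M *ᵥ w)) := by
    rw [dotProduct_mulVec, dotProduct_mulVec v, vecMul_transpose, ← mulVec_transpose, hM.eq,
      dotProduct_comm]
  simp only [add_mulVec, dotProduct_add, ← mulVec_mulVec] at h
  rw [hswap, h, dotProduct_mulVec v Rᵀ, vecMul_transpose]

/-- The energy rate of one element depends only on boundary values and interface fluxes. -/
lemma dotProduct_mulVec_cpr_rate {n : Type*} [Fintype n] [DecidableEq n]
    {M D : Matrix n n ℝ} {R : Matrix (Fin 2) n ℝ} (hM : M.IsSymm) (hMu : IsUnit M.det)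
    (hSBP : M * D + Dᵀ * M = Rᵀ * !![(-1 : ℝ), 0; 0, 1] * R)
    (u : n → ℝ) (U : Matrix n n ℝ) (f : Fin 2 → ℝ) :
    u ⬝ᵥ (M *ᵥ (-((D *ᵥ ((1/2 : ℝ) • (U *ᵥ u)))
        + (1/3 : ℝ) • (M⁻¹ *ᵥ (Uᵀ *ᵥ (M *ᵥ (D *ᵥ u))) - (1/2 : ℝ) • (D *ᵥ (U *ᵥ u)))
        + M⁻¹ *ᵥ (Rᵀ *ᵥ (!![(-1 : ℝ), 0; 0, 1] *ᵥ (f - R *ᵥ ((1/2 : ℝ) • (U *ᵥ u))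
          - (1/6 : ℝ) • ((R *ᵥ u) * (R *ᵥ u) - R *ᵥ (U *ᵥ u)))))))) =
      (1/6 : ℝ) * (((R *ᵥ u) 1)^3 - ((R *ᵥ u) 0)^3)
        - ((R *ᵥ u) 1 * f 1 - (R *ᵥ u) 0 * f 0) := by
  have hinv (x : n → ℝ) : M *ᵥ (M⁻¹ *ᵥ x) = x := by
    rw [mulVec_mulVec, mul_nonsing_inv M hMu, one_mulVec]
  have hsbp := dotProduct_mulVec_add_of_sbp hM hSBP u (U *ᵥ u)
  have hR (y : Fin 2 → ℝ) : u ⬝ᵥ (Rᵀ *ᵥ y) = (R *ᵥ u) ⬝ᵥ y := by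
    rw [dotProduct_mulVec, vecMul_transpose]
  have hU (y : n → ℝ) : u ⬝ᵥ (Uᵀ *ᵥ y) = (U *ᵥ u) ⬝ᵥ y := by
    rw [dotProduct_mulVec, vecMul_transpose]
  simp only [mulVec_neg, mulVec_add, mulVec_sub M, mulVec_smul, hinv, dotProduct_neg,
    dotProduct_add, dotProduct_sub u, dotProduct_smul, hR, hU, smul_eq_mul]
  generalize R *ᵥ (U *ᵥ u) = w at *
  generalize R *ᵥ u = v at *
  simp [dotProduct, mulVec, Fin.sum_univ_two] at hsbp ⊢
  linear_combination (-1/3) * hsbp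

/-- (Theorem 2, stability part.) Under the periodic SBP CPR semidiscretisation
of Burgers' equation with generalised correction terms, if the interface fluxes
are entropy stable, then the total discrete energy is nonincreasing. -/
theorem stmt_4 (n : ℕ) (hn : 1 ≤ n)
    (M D : Matrix (Fin n) (Fin n) ℝ) (R : Matrix (Fin 2) (Fin n) ℝ)
    (B : Matrix (Fin 2) (Fin 2) ℝ) (hB : B = !![(-1 : ℝ), 0; 0, 1])
    (hM : M.IsSymm) (hMpd : M.PosDef)
    (hSBP : M * D + Dᵀ * M = Rᵀ * B * R)
    (N : ℕ) [NeZero N]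
    (u : ZMod N → Fin n → ℝ) (U : ZMod N → Matrix (Fin n) (Fin n) ℝ)
    (g : ZMod N → ℝ)
    (fnum : ZMod N → Fin 2 → ℝ) (hfnum : ∀ k, fnum k = ![g (k - 1), g k])
    (cdiv : ZMod N → Fin n → ℝ)
    (hcdiv : ∀ k, cdiv k = (1/3 : ℝ) •
      (M⁻¹ *ᵥ ((U k)ᵀ *ᵥ (M *ᵥ (D *ᵥ u k))) - (1/2 : ℝ) • (D *ᵥ (U k *ᵥ u k))))
    (cres : ZMod N → Fin 2 → ℝ)
    (hcres : ∀ k, cres k = (1/6 : ℝ) • ((R *ᵥ u k) * (R *ᵥ u k) - R *ᵥ (U k *ᵥ u k)))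
    (du : ZMod N → Fin n → ℝ)
    (hdu : ∀ k, du k = -((D *ᵥ ((1/2 : ℝ) • (U k *ᵥ u k))) + cdiv k
        + M⁻¹ *ᵥ (Rᵀ *ᵥ (B *ᵥ (fnum k - R *ᵥ ((1/2 : ℝ) • (U k *ᵥ u k)) - cres k)))))
    (hflux : ∀ k : ZMod N,
      (1/6 : ℝ) * (((R *ᵥ u k) 1)^3 - ((R *ᵥ u (k + 1)) 0)^3)
        - ((R *ᵥ u k) 1 - (R *ᵥ u (k + 1)) 0) * g k ≤ 0) :
    ∑ k : ZMod N, u k ⬝ᵥ (M *ᵥ du k) ≤ 0 := by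
  subst hB
  have hrate (k : ZMod N) : u k ⬝ᵥ (M *ᵥ du k) =
      ((1/6 : ℝ) * ((R *ᵥ u k) 1)^3 - (R *ᵥ u k) 1 * g k)
        - ((1/6 : ℝ) * ((R *ᵥ u k) 0)^3 - (R *ᵥ u k) 0 * g (k - 1)) := by
    rw [hdu, hcdiv, hcres, hfnum,
      dotProduct_mulVec_cpr_rate hM ((isUnit_iff_isUnit_det M).mp hMpd.isUnit) hSBP]
    simp only [cons_val_zero, cons_val_one]
    ring
  have hshift := Equiv.sum_comp (Equiv.addRight (1 : ZMod N))
    (fun k => (1/6 : ℝ) * ((R *ᵥ u k) 0)^3 - (R *ᵥ u k) 0 * g (k - 1))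
  simp only [Equiv.coe_addRight, add_sub_cancel_right] at hshift
  simp only [hrate]
  rw [Finset.sum_sub_distrib, ← hshift, ← Finset.sum_sub_distrib]
  refine Finset.sum_nonpos fun k _ => ?_
  linarith [hflux k]
end

section
/- The local Lax-Friedrichs (LLF) flux for Burgers' equation is entropy stable: for all u₋, u₊ ∈ ℝ, with f = (1/4)·(u₊² + u₋²) − (max(|u₊|, |u₋|)/2)·(u₊ − u₋), one has (1/6)·(u₋³ − u₊³) − (u₋ − u₊)·f ≤ 0. -/
/-- The local Lax-Friedrichs (LLF) flux for Burgers' equation is entropy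
stable. -/
theorem stmt_7 (um up f : ℝ)
    (hf : f = (1/4 : ℝ) * (up^2 + um^2) - (max |up| |um| / 2) * (up - um)) :
    (1/6 : ℝ) * (um^3 - up^3) - (um - up) * f ≤ 0 := by
  have hup : up ≤ max |up| |um| := (le_abs_self up).trans (le_max_left _ _)
  have hum : -um ≤ max |up| |um| := (neg_le_abs um).trans (le_max_right _ _)
  have hM : 0 ≤ max |up| |um| := (abs_nonneg up).trans (le_max_left _ _)
  have h : 0 ≤ (up - um)^2 * (6 * max |up| |um| - (up - um)) :=
    mul_nonneg (sq_nonneg _) (by linarith)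
  subst hf
  linear_combination h / 12
end

section
/- Osher's flux for Burgers' equation is entropy stable: for all u₋, u₊ ∈ ℝ, with f defined by f = u₋²/2 if u₋ > 0 and u₊ > 0; f = u₊²/2 if u₋ < 0 and u₊ < 0; f = u₋²/2 + u₊²/2 if u₋ ≥ 0 ≥ u₊; and f = 0 if u₋ ≤ 0 ≤ u₊, one has (1/6)·(u₋³ − u₊³) − (u₋ − u₊)·f ≤ 0. -/
/-- Osher's flux for Burgers' equation is entropy stable. -/
theorem stmt_8 (um up f : ℝ)
    (h1 : um > 0 → up > 0 → f = um^2 / 2)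
    (h2 : um < 0 → up < 0 → f = up^2 / 2)
    (h3 : um ≥ 0 → 0 ≥ up → f = um^2 / 2 + up^2 / 2)
    (h4 : um ≤ 0 → 0 ≤ up → f = 0) :
    (1/6 : ℝ) * (um^3 - up^3) - (um - up) * f ≤ 0 := by
  rcases lt_or_ge 0 um with ha | ha <;> rcases lt_or_ge 0 up with hb | hb
  · rw [h1 ha hb]
    nlinarith [mul_nonneg (sq_nonneg (um - up)) (by linarith : 0 ≤ up + 2 * um)]
  · rw [h3 ha.le hb]
    nlinarith [mul_nonneg (by linarith : 0 ≤ um - up)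
      (by nlinarith [sq_nonneg (um - up)] : 0 ≤ 2 * um ^ 2 - um * up + 2 * up ^ 2)]
  · rw [h4 ha hb.le]
    nlinarith [mul_nonneg (by linarith : 0 ≤ up - um)
      (by nlinarith [sq_nonneg (um + up)] : 0 ≤ um ^ 2 + um * up + up ^ 2)]
  · have hf : f = up ^ 2 / 2 := by
      rcases ha.lt_or_eq with ha' | rfl
      · rcases hb.lt_or_eq with hb' | rfl
        · rw [h2 ha' hb']
        · rw [h4 ha le_rfl]; ring
      · rw [h3 le_rfl hb]; ring
    rw [hf]
    nlinarith [mul_nonneg (sq_nonneg (um - up)) (by linarith : 0 ≤ -(um + 2 * up))]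
end

section
/- Under the periodic SBP CPR semidiscretisation of Burgers' equation with generalised correction terms, if each interface flux is the energy conservative flux, g_k = (1/4)·((u⁺_k)² + (u⁻_k)²) − (u⁺_k − u⁻_k)²/12, then the total discrete energy is exactly conserved: Σ_{k ∈ ZMod N} (u_k)ᵀ·M·du_k = 0. -/
open Matrix

/-- Discrete integration by parts for a summation-by-parts operator. -/
theorem sbp_integration_by_parts {m n : Type*} [Fintype m] [Fintype n]
    {M D : Matrix n n ℝ} {R : Matrix m n ℝ} {B : Matrix m m ℝ} (hM : M.IsSymm)
    (hSBP : M * D + Dᵀ * M = Rᵀ * B * R) (u w : n → ℝ) :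
    u ⬝ᵥ (M *ᵥ (D *ᵥ w)) + w ⬝ᵥ (M *ᵥ (D *ᵥ u)) = (R *ᵥ u) ⬝ᵥ (B *ᵥ (R *ᵥ w)) := by
  have h : w ⬝ᵥ (M *ᵥ (D *ᵥ u)) = u ⬝ᵥ (Dᵀ *ᵥ (M *ᵥ w)) := by
    rw [dotProduct_mulVec, ← mulVec_transpose, hM.eq, dotProduct_mulVec, ← mulVec_transpose,
      dotProduct_comm]
  rw [h, mulVec_mulVec, mulVec_mulVec, ← dotProduct_add, ← add_mulVec, hSBP, ← mulVec_mulVec,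
    ← mulVec_mulVec, dotProduct_mulVec, vecMul_transpose]

/-- The energy rate of a single element depends only on the boundary values and the numerical
flux, whatever the multiplication operator `U` is. -/
theorem energy_rate_eq_boundary_terms {m n : Type*} [Fintype m] [Fintype n] [DecidableEq n]
    {M D : Matrix n n ℝ} {R : Matrix m n ℝ} {B : Matrix m m ℝ} (hM : M.IsSymm)
    (hdet : IsUnit M.det) (hSBP : M * D + Dᵀ * M = Rᵀ * B * R)
    (U : Matrix n n ℝ) (u : n → ℝ) (f : m → ℝ) :
    u ⬝ᵥ (M *ᵥ -((D *ᵥ ((1/2 : ℝ) • (U *ᵥ u)))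
        + (1/3 : ℝ) • (M⁻¹ *ᵥ (Uᵀ *ᵥ (M *ᵥ (D *ᵥ u))) - (1/2 : ℝ) • (D *ᵥ (U *ᵥ u)))
        + M⁻¹ *ᵥ (Rᵀ *ᵥ (B *ᵥ (f - R *ᵥ ((1/2 : ℝ) • (U *ᵥ u))
          - (1/6 : ℝ) • ((R *ᵥ u) * (R *ᵥ u) - R *ᵥ (U *ᵥ u)))))))
      = (1/6 : ℝ) * ((R *ᵥ u) ⬝ᵥ (B *ᵥ ((R *ᵥ u) * (R *ᵥ u)))) - (R *ᵥ u) ⬝ᵥ (B *ᵥ f) := by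
  have hinv (v : n → ℝ) : M *ᵥ (M⁻¹ *ᵥ v) = v := by
    rw [mulVec_mulVec, mul_nonsing_inv _ hdet, one_mulVec]
  have hU (v : n → ℝ) : u ⬝ᵥ (Uᵀ *ᵥ v) = (U *ᵥ u) ⬝ᵥ v := by
    rw [dotProduct_mulVec, vecMul_transpose]
  have hR (v : m → ℝ) : u ⬝ᵥ (Rᵀ *ᵥ v) = (R *ᵥ u) ⬝ᵥ v := by
    rw [dotProduct_mulVec, vecMul_transpose]
  have h := sbp_integration_by_parts hM hSBP u (U *ᵥ u)
  simp only [mulVec_neg, mulVec_add, mulVec_sub, mulVec_smul, dotProduct_neg, dotProduct_add,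
    dotProduct_sub, dotProduct_smul, smul_eq_mul, hinv, hU, hR]
  linarith

/-- Under the periodic SBP CPR semidiscretisation of Burgers' equation with
generalised correction terms, if each interface flux is the energy conservative
flux, then the total discrete energy is exactly conserved. -/
theorem stmt_9 (n : ℕ) (hn : 1 ≤ n)
    (M D : Matrix (Fin n) (Fin n) ℝ) (R : Matrix (Fin 2) (Fin n) ℝ)
    (B : Matrix (Fin 2) (Fin 2) ℝ) (hB : B = !![(-1 : ℝ), 0; 0, 1])
    (hM : M.IsSymm) (hMpd : M.PosDef)
    (hSBP : M * D + Dᵀ * M = Rᵀ * B * R)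
    (N : ℕ) [NeZero N]
    (u : ZMod N → Fin n → ℝ) (U : ZMod N → Matrix (Fin n) (Fin n) ℝ)
    (g : ZMod N → ℝ)
    (fnum : ZMod N → Fin 2 → ℝ) (hfnum : ∀ k, fnum k = ![g (k - 1), g k])
    (cdiv : ZMod N → Fin n → ℝ)
    (hcdiv : ∀ k, cdiv k = (1/3 : ℝ) •
      (M⁻¹ *ᵥ ((U k)ᵀ *ᵥ (M *ᵥ (D *ᵥ u k))) - (1/2 : ℝ) • (D *ᵥ (U k *ᵥ u k))))
    (cres : ZMod N → Fin 2 → ℝ)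
    (hcres : ∀ k, cres k = (1/6 : ℝ) • ((R *ᵥ u k) * (R *ᵥ u k) - R *ᵥ (U k *ᵥ u k)))
    (du : ZMod N → Fin n → ℝ)
    (hdu : ∀ k, du k = -((D *ᵥ ((1/2 : ℝ) • (U k *ᵥ u k))) + cdiv k
        + M⁻¹ *ᵥ (Rᵀ *ᵥ (B *ᵥ (fnum k - R *ᵥ ((1/2 : ℝ) • (U k *ᵥ u k)) - cres k)))))
    (hg : ∀ k : ZMod N,
      g k = (1/4 : ℝ) * (((R *ᵥ u (k + 1)) 0)^2 + ((R *ᵥ u k) 1)^2)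
        - ((R *ᵥ u (k + 1)) 0 - (R *ᵥ u k) 1)^2 / 12) :
    ∑ k : ZMod N, u k ⬝ᵥ (M *ᵥ du k) = 0 := by
  have hdet : IsUnit M.det := hMpd.det_pos.ne'.isUnit
  have key (k : ZMod N) : u k ⬝ᵥ (M *ᵥ du k) =
      ((R *ᵥ u k) 0 * g (k - 1) - ((R *ᵥ u k) 0) ^ 3 / 6)
        - ((R *ᵥ u k) 1 * g k - ((R *ᵥ u k) 1) ^ 3 / 6) := by
    rw [hdu, hcdiv, hcres, energy_rate_eq_boundary_terms hM hdet hSBP, hfnum, hB]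
    generalize R *ᵥ u k = a
    simp [dotProduct, mulVec, Fin.sum_univ_two]
    ring
  have shift : ∑ k : ZMod N, ((R *ᵥ u k) 0 * g (k - 1) - ((R *ᵥ u k) 0) ^ 3 / 6) =
      ∑ k : ZMod N, ((R *ᵥ u (k + 1)) 0 * g k - ((R *ᵥ u (k + 1)) 0) ^ 3 / 6) := by
    rw [← Equiv.sum_comp (Equiv.addRight (1 : ZMod N))]
    simp
  rw [Finset.sum_congr rfl fun k _ => key k, Finset.sum_sub_distrib, shift,
    ← Finset.sum_sub_distrib]
  refine Finset.sum_eq_zero fun k _ => ?_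
  rw [hg]
  ring
end

section
/- If the discrete operators exactly reproduce integration and boundary evaluation of polynomials, then the SBP property holds: let n ≥ 1, let φ : ℝⁿ → ℝ[X] be a linear map into real polynomials, let M, D ∈ ℝ^{n×n} with M symmetric, R ∈ ℝ^{2×n}, B = diag(−1, 1), and suppose that for all x, y ∈ ℝⁿ: xᵀ·M·D·y = ∫_{−1}^{1} φ(x)(t)·(φ(y))′(t) dt (where (φ(y))′ is the polynomial derivative), (R·x)₀ = φ(x)(−1) and (R·x)₁ = φ(x)(1), and the form x, y ↦ xᵀ·M·y is nondegenerate resp. the identities determine the matrices (it suffices that the stated identities hold for all x, y). Then M·D + Dᵀ·M = Rᵀ·B·R. -/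
open Matrix

theorem integral_eval_mul_derivative_add (p q : Polynomial ℝ) (a b : ℝ) :
    (∫ t in a..b, p.eval t * q.derivative.eval t) + (∫ t in a..b, q.eval t * p.derivative.eval t)
      = p.eval b * q.eval b - p.eval a * q.eval a := by
  rw [intervalIntegral.integral_mul_deriv_eq_deriv_mul
    (fun t _ => p.hasDerivAt t) (fun t _ => q.hasDerivAt t)
    (p.derivative.continuous.intervalIntegrable a b)
    (q.derivative.continuous.intervalIntegrable a b)]
  simp only [mul_comm (p.derivative.eval _), sub_add_cancel]

/-- If the discrete operators exactly reproduce integration and boundary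
evaluation of polynomials, then the SBP property `M·D + Dᵀ·M = Rᵀ·B·R` holds. -/
theorem stmt_11 (n : ℕ) (hn : 1 ≤ n)
    (φ : (Fin n → ℝ) →ₗ[ℝ] Polynomial ℝ)
    (M D : Matrix (Fin n) (Fin n) ℝ) (R : Matrix (Fin 2) (Fin n) ℝ)
    (B : Matrix (Fin 2) (Fin 2) ℝ) (hB : B = !![(-1 : ℝ), 0; 0, 1])
    (hM : M.IsSymm)
    (hMD : ∀ x y : Fin n → ℝ, x ⬝ᵥ (M *ᵥ (D *ᵥ y))
      = ∫ t in (-1 : ℝ)..1, (φ x).eval t * ((Polynomial.derivative (φ y)).eval t))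
    (hR0 : ∀ x : Fin n → ℝ, (R *ᵥ x) 0 = (φ x).eval (-1))
    (hR1 : ∀ x : Fin n → ℝ, (R *ᵥ x) 1 = (φ x).eval 1) :
    M * D + Dᵀ * M = Rᵀ * B * R := by
  have entry (i j : Fin n) : (M * D) i j = ∫ t in (-1 : ℝ)..1,
      (φ (Pi.single i 1)).eval t * (φ (Pi.single j 1)).derivative.eval t := by
    rw [← hMD, mulVec_mulVec]
    simp
  have hsymm : Dᵀ * M = (M * D)ᵀ := by rw [transpose_mul, hM.eq]
  ext i j
  rw [hsymm, Matrix.add_apply, transpose_apply, entry, entry, integral_eval_mul_derivative_add,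
    ← hR0, ← hR0, ← hR1, ← hR1, hB]
  simp [mul_apply, Fin.sum_univ_two]
  ring
end

section
/- (Curvilinear energy identity.) Let M, D ∈ ℝ^{n×n}, R ∈ ℝ^{2×n}, B = diag(−1, 1) satisfy the SBP property M·D + Dᵀ·M = Rᵀ·B·R, with M symmetric and invertible. Then for any u ∈ ℝⁿ and fnum ∈ ℝ², the vector w = −( D·u + M⁻¹·Rᵀ·B·(fnum − R·u) ) satisfies uᵀ·M·w = −uᵀ·Rᵀ·B·(fnum − (1/2)·R·u). -/
open Matrix

/-- Summation by parts on the diagonal: the quadratic form of `M * D` is half of that of the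
boundary matrix `Q = M * D + Dᵀ * M`. -/
theorem two_mul_dotProduct_mulVec_of_sbp {ι : Type*} [Fintype ι] {M D Q : Matrix ι ι ℝ}
    (hM : M.IsSymm) (hSBP : M * D + Dᵀ * M = Q) (u : ι → ℝ) :
    2 * (u ⬝ᵥ (M *ᵥ (D *ᵥ u))) = u ⬝ᵥ (Q *ᵥ u) := by
  have h : u ⬝ᵥ ((Dᵀ * M) *ᵥ u) = u ⬝ᵥ ((M * D) *ᵥ u) := by
    rw [← dotProduct_transpose_mulVec, transpose_mul, transpose_transpose, hM.eq]
  rw [← hSBP, add_mulVec, dotProduct_add, h, mulVec_mulVec, two_mul]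

/-- (Curvilinear energy identity.) With the SBP property and `M` symmetric and
invertible, `w = −(D·u + M⁻¹·Rᵀ·B·(fnum − R·u))` satisfies
`uᵀ·M·w = −uᵀ·Rᵀ·B·(fnum − (1/2)·R·u)`. -/
theorem stmt_15 (n : ℕ) (hn : 1 ≤ n)
    (M D : Matrix (Fin n) (Fin n) ℝ) (R : Matrix (Fin 2) (Fin n) ℝ)
    (B : Matrix (Fin 2) (Fin 2) ℝ) (hB : B = !![(-1 : ℝ), 0; 0, 1])
    (hM : M.IsSymm) (hMinv : IsUnit M.det)
    (hSBP : M * D + Dᵀ * M = Rᵀ * B * R)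
    (u : Fin n → ℝ) (fnum : Fin 2 → ℝ)
    (w : Fin n → ℝ)
    (hw : w = -((D *ᵥ u) + M⁻¹ *ᵥ (Rᵀ *ᵥ (B *ᵥ (fnum - R *ᵥ u))))) :
    u ⬝ᵥ (M *ᵥ w)
      = - (u ⬝ᵥ (Rᵀ *ᵥ (B *ᵥ (fnum - (1/2 : ℝ) • (R *ᵥ u))))) := by
  have h := two_mul_dotProduct_mulVec_of_sbp hM hSBP u
  rw [← mulVec_mulVec, ← mulVec_mulVec] at h
  have hMw : M *ᵥ w = -(M *ᵥ (D *ᵥ u) + Rᵀ *ᵥ (B *ᵥ (fnum - R *ᵥ u))) := by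
    rw [hw, mulVec_neg, mulVec_add, mulVec_mulVec _ M M⁻¹, mul_nonsing_inv M hMinv, one_mulVec]
  simp only [hMw, mulVec_sub, mulVec_smul, dotProduct_neg, dotProduct_add, dotProduct_sub,
    dotProduct_smul, smul_eq_mul]
  linarith
end

section
/- (Curvilinear global energy conservation with central flux.) Let M, D ∈ ℝ^{n×n}, R ∈ ℝ^{2×n}, B = diag(−1, 1) satisfy the SBP property M·D + Dᵀ·M = Rᵀ·B·R, with M symmetric and invertible. Consider N ≥ 1 periodic elements with solution vectors u_k ∈ ℝⁿ (k ∈ ZMod N), central interface fluxes g_k = ((R·u_k)₁ + (R·u_{k+1})₀)/2, per-element flux vectors fnum_k = (g_{k−1}, g_k), and w_k = −( D·u_k + M⁻¹·Rᵀ·B·(fnum_k − R·u_k) ). Then Σ_{k ∈ ZMod N} (u_k)ᵀ·M·w_k = 0; in particular, if each element has a discrete Jacobian J_k with M·J_k symmetric and J_k·(∂ₜu_k) = w_k·(scaled appropriately), the total energy Σ_k (u_k)ᵀ·M·J_k·u_k is constant in time. -/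
open Matrix

/-- The energy rate of one SBP CPR element with flux vector `f` in terms of boundary values. -/
theorem sbp_element_energy_rate {n : ℕ} {M D : Matrix (Fin n) (Fin n) ℝ}
    {R : Matrix (Fin 2) (Fin n) ℝ} (hM : M.IsSymm) (hMinv : IsUnit M.det)
    (hSBP : M * D + Dᵀ * M = Rᵀ * !![(-1 : ℝ), 0; 0, 1] * R) (u : Fin n → ℝ) (f : Fin 2 → ℝ) :
    u ⬝ᵥ (M *ᵥ -(D *ᵥ u + M⁻¹ *ᵥ (Rᵀ *ᵥ (!![(-1 : ℝ), 0; 0, 1] *ᵥ (f - R *ᵥ u))))) =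
      ((R *ᵥ u) 1 ^ 2 - (R *ᵥ u) 0 ^ 2) / 2 + (R *ᵥ u) 0 * f 0 - (R *ᵥ u) 1 * f 1 := by
  have transpose_dot (v : Fin 2 → ℝ) : u ⬝ᵥ (Rᵀ *ᵥ v) = (R *ᵥ u) ⬝ᵥ v := by
    rw [dotProduct_mulVec, vecMul_transpose]
  have volume_symm : u ⬝ᵥ ((Dᵀ * M) *ᵥ u) = u ⬝ᵥ ((M * D) *ᵥ u) := by
    have h : Dᵀ * M = (M * D)ᵀ := by rw [transpose_mul, hM.eq]
    rw [h, dotProduct_mulVec, vecMul_transpose, dotProduct_comm]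
  have volume : 2 * (u ⬝ᵥ ((M * D) *ᵥ u)) = (R *ᵥ u) 1 ^ 2 - (R *ᵥ u) 0 ^ 2 := by
    have h := congrArg (fun A => u ⬝ᵥ (A *ᵥ u)) hSBP
    simp only [add_mulVec, dotProduct_add, volume_symm] at h
    rw [two_mul, h, ← mulVec_mulVec, ← mulVec_mulVec, transpose_dot]
    generalize R *ᵥ u = v
    simp [dotProduct, mulVec, Fin.sum_univ_two]
    ring
  rw [mulVec_neg, mulVec_add, mulVec_mulVec, mulVec_mulVec, mul_nonsing_inv M hMinv, one_mulVec,
    dotProduct_neg, dotProduct_add, transpose_dot]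
  generalize R *ᵥ u = v at volume ⊢
  simp [dotProduct, mulVec, Fin.sum_univ_two] at volume ⊢
  linarith

/-- (Curvilinear global energy conservation with central flux.) With the SBP
property and `M` symmetric and invertible, for `N` periodically coupled
elements with central interface fluxes, the total discrete energy rate
vanishes: `Σ_k (u_k)ᵀ·M·w_k = 0`. -/
theorem stmt_16 (n : ℕ) (hn : 1 ≤ n)
    (M D : Matrix (Fin n) (Fin n) ℝ) (R : Matrix (Fin 2) (Fin n) ℝ)
    (B : Matrix (Fin 2) (Fin 2) ℝ) (hB : B = !![(-1 : ℝ), 0; 0, 1])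
    (hM : M.IsSymm) (hMinv : IsUnit M.det)
    (hSBP : M * D + Dᵀ * M = Rᵀ * B * R)
    (N : ℕ) [NeZero N]
    (u : ZMod N → Fin n → ℝ)
    (g : ZMod N → ℝ)
    (hg : ∀ k : ZMod N, g k = ((R *ᵥ u k) 1 + (R *ᵥ u (k + 1)) 0) / 2)
    (fnum : ZMod N → Fin 2 → ℝ) (hfnum : ∀ k, fnum k = ![g (k - 1), g k])
    (w : ZMod N → Fin n → ℝ)
    (hw : ∀ k, w k = -((D *ᵥ u k) + M⁻¹ *ᵥ (Rᵀ *ᵥ (B *ᵥ (fnum k - R *ᵥ u k))))) :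
    ∑ k : ZMod N, u k ⬝ᵥ (M *ᵥ w k) = 0 := by
  subst hB
  have rate (k : ZMod N) : u k ⬝ᵥ (M *ᵥ w k) =
      (R *ᵥ u (k - 1)) 1 * (R *ᵥ u (k - 1 + 1)) 0 / 2 -
        (R *ᵥ u k) 1 * (R *ᵥ u (k + 1)) 0 / 2 := by
    rw [hw, sbp_element_energy_rate hM hMinv hSBP, hfnum, cons_val_zero, cons_val_one,
      cons_val_fin_one, hg, hg, sub_add_cancel]
    ring
  simp_rw [rate]
  rw [Finset.sum_sub_distrib, sub_eq_zero]
  exact (Equiv.subRight (1 : ZMod N)).sum_comp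
    fun k => (R *ᵥ u k) 1 * (R *ᵥ u (k + 1)) 0 / 2
end
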